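/- Let L' be the tree obtained from a path x_0 x_1 … x_10 on 11 vertices by attaching a pendant path of two vertices to x_4 and a pendant path of two vertices to x_7. Then: (a) there is no (2,2,3,3)-packing coloring c of L' with {c(x_0), c(x_10)} = {3, 4}, i.e., x_0 and x_10 never receive distinct colors from the two 3-packing classes; and (b) there exists a (2,2,3,3)-packing coloring of L' with c(x_0) = c(x_10) = 3. -/

import Mathlib

/-- `c` is an `s`-packing coloring of the simple graph `G`: for each color `i`, any two
distinct vertices with color `i` are at graph distance strictly greater than `s i`
(vertices in different connected components trivially satisfy this). -/
def IsPackingColoring {V : Type*} (G : SimpleGraph V) {k : ℕ} (s : Fin k → ℕ)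
    (c : V → Fin k) : Prop :=
  ∀ u v : V, u ≠ v → c u = c v → G.Reachable u v → s (c u) < G.dist u v

/-- The tree `L'`: a path `x₀ x₁ … x₁₀` (vertices `0,…,10`) with a pendant path of two
vertices (`11-12`) attached to `x₄` and a pendant path of two vertices (`13-14`)
attached to `x₇`. -/
def treeL' : SimpleGraph (Fin 15) :=
  SimpleGraph.fromRel (fun u v =>
    (u, v) ∈ ([(0,1),(1,2),(2,3),(3,4),(4,5),(5,6),(6,7),(7,8),(8,9),(9,10),
               (4,11),(11,12),(7,13),(13,14)] : List (Fin 15 × Fin 15)))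

/-- The number of the path vertex `xᵢ` whose pendant path contains `v`. -/
def treeL'Foot (v : Fin 15) : ℕ :=
  if v ≤ 10 then v else if v ≤ 12 then 4 else 7

/-- The distance from `v` to the path `x₀ x₁ … x₁₀`. -/
def treeL'Height (v : Fin 15) : ℕ :=
  if v ≤ 10 then 0 else if v = 11 ∨ v = 13 then 1 else 2

/-- An explicit formula for the distance in `treeL'`. -/
def treeL'Dist (u v : Fin 15) : ℕ :=
  if treeL'Foot u = treeL'Foot v then Nat.dist (treeL'Height u) (treeL'Height v)
  else Nat.dist (treeL'Foot u) (treeL'Foot v) + treeL'Height u + treeL'Height v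

/-- A function to `ℕ` that vanishes at `v`, grows by at most one along each edge, and decreases
along some edge at every vertex other than `v`, is the distance to `v`. -/
theorem reachable_and_dist_eq_of_descent {V : Type*} {G : SimpleGraph V} {v : V} {f : V → ℕ}
    (hv : f v = 0) (hle : ∀ a b, G.Adj a b → f a ≤ f b + 1)
    (hdesc : ∀ a, a ≠ v → ∃ b, G.Adj a b ∧ f a = f b + 1) (u : V) :
    G.Reachable u v ∧ G.dist u v = f u := by
  have lower : ∀ {a b : V} (p : G.Walk a b), f a ≤ f b + p.length := by
    intro a b p
    induction p with
    | nil => simp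
    | cons h p ih =>
      have := hle _ _ h
      rw [SimpleGraph.Walk.length_cons]
      omega
  have upper : ∀ n a, f a = n → ∃ p : G.Walk a v, p.length = n := by
    intro n
    induction n with
    | zero =>
      intro a ha
      have hav : a = v := by
        by_contra hne
        obtain ⟨b, -, hb⟩ := hdesc a hne
        omega
      subst hav
      exact ⟨.nil, rfl⟩
    | succ n ih =>
      intro a ha
      have hne : a ≠ v := by
        rintro rfl
        omega
      obtain ⟨b, hab, hb⟩ := hdesc a hne
      obtain ⟨p, hp⟩ := ih b (by omega)
      exact ⟨.cons hab p, by rw [SimpleGraph.Walk.length_cons, hp]⟩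
  obtain ⟨p, hp⟩ := upper _ u rfl
  obtain ⟨q, hq⟩ := p.reachable.exists_walk_length_eq_dist
  have h₁ := SimpleGraph.dist_le p
  have h₂ := lower q
  exact ⟨p.reachable, by omega⟩

instance : DecidableRel treeL'.Adj := fun u v =>
  decidable_of_iff _ (SimpleGraph.fromRel_adj _ u v).symm

theorem treeL'_reachable_and_dist (u v : Fin 15) :
    treeL'.Reachable u v ∧ treeL'.dist u v = treeL'Dist u v := by
  refine reachable_and_dist_eq_of_descent (f := fun a => treeL'Dist a v) ?_ ?_ ?_ u
  · simp [treeL'Dist]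
  · revert v
    decide +kernel
  · revert v
    decide +kernel

theorem isPackingColoring_treeL'_iff {k : ℕ} (s : Fin k → ℕ) (c : Fin 15 → Fin k) :
    IsPackingColoring treeL' s c ↔
      ∀ u v, u ≠ v → c u = c v → s (c u) < treeL'Dist u v := by
  simp [IsPackingColoring, treeL'_reachable_and_dist]

/-- Backtracking search: can the partial coloring `p` be extended to the vertices in the list so
that each color `i` is used only on vertices at `d`-distance greater than `s i`? -/
def packingExtends {V : Type*} [DecidableEq V] {k : ℕ} (d : V → V → ℕ) (s : Fin k → ℕ) :
    List V → List (V × Fin k) → Bool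
  | [], _ => true
  | v :: vs, p => (List.finRange k).any fun i =>
      p.all (fun q => decide (q.1 ≠ v → q.2 = i → s q.2 < d q.1 v)) &&
        packingExtends d s vs ((v, i) :: p)

theorem packingExtends_eq_true {V : Type*} [DecidableEq V] {k : ℕ} {d : V → V → ℕ}
    {s : Fin k → ℕ} {c : V → Fin k} (hc : ∀ u v, u ≠ v → c u = c v → s (c u) < d u v)
    (vs : List V) (p : List (V × Fin k)) (hp : ∀ q ∈ p, c q.1 = q.2) :
    packingExtends d s vs p = true := by
  induction vs generalizing p with
  | nil => rfl
  | cons v vs ih =>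
    simp only [packingExtends, List.any_eq_true, Bool.and_eq_true, List.all_eq_true,
      decide_eq_true_eq]
    refine ⟨c v, List.mem_finRange _, fun q hq hne hqv => ?_, ih _ fun q hq => ?_⟩
    · rw [← hp q hq] at hqv ⊢
      exact hc _ _ hne hqv
    · rcases List.mem_cons.mp hq with rfl | hq
      · rfl
      · exact hp q hq

/-- In a `(2,2,3,3)`-packing coloring (colors `2` and `3` are the two `3`-packing
classes): (a) `x₀` and `x₁₀` never receive distinct colors from `{2, 3}`;
(b) there is a coloring where `x₀` and `x₁₀` both receive color `2`. -/
theorem treeL'_transmitter :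
    (¬ ∃ c : Fin 15 → Fin 4, IsPackingColoring treeL' ![2, 2, 3, 3] c ∧
        ((c 0 = 2 ∧ c 10 = 3) ∨ (c 0 = 3 ∧ c 10 = 2))) ∧
    (∃ c : Fin 15 → Fin 4, IsPackingColoring treeL' ![2, 2, 3, 3] c ∧
        c 0 = 2 ∧ c 10 = 2) := by
  simp only [isPackingColoring_treeL'_iff]
  refine ⟨?_, ![2, 0, 1, 3, 2, 0, 1, 3, 0, 1, 2, 1, 0, 2, 0], by decide +kernel, rfl, rfl⟩
  have contra : ∀ a b : Fin 4, (a = 2 ∧ b = 3 ∨ a = 3 ∧ b = 2) →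
      packingExtends treeL'Dist ![2, 2, 3, 3] [9, 8, 7, 13, 6, 5, 4, 11, 3, 2, 1]
        [(0, a), (10, b)] = false := by
    decide +kernel
  rintro ⟨c, hc, h⟩
  have := packingExtends_eq_true hc [9, 8, 7, 13, 6, 5, 4, 11, 3, 2, 1]
    [(0, c 0), (10, c 10)] (by simp)
  simp [contra _ _ h] at this
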